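/- Let d ≥ 1 and consider an elliptic probability law ℙ on the environment space Ω under which {ω(x) : x ∈ ℤ^d} are i.i.d. Assume that there exists r > 1 such that ℙ-almost surely ω(0,e_1) = r·ω(0,e_{1+d}). Then there exist M ≥ 15d+5 and L ≥ c_0 such that the polynomial condition (P)_M in direction e_1 is satisfied on a box of size L. -/

import Mathlib

open MeasureTheory Filter Topology
open scoped ENNReal NNReal Classical BigOperators

namespace RWRE

/-- Sites of the lattice `ℤ^d`. -/
abbrev V (d : ℕ) := Fin d → ℤ

/-- The `2d` canonical unit vectors: `dir d i = e_{i+1}` for `i < d`, and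
`dir d i = -e_{i-d+1}` for `d ≤ i < 2d`. -/
def dir (d : ℕ) (i : Fin (2 * d)) : V d :=
  fun j => if (j : ℕ) = (i : ℕ) ∨ (j : ℕ) + d = (i : ℕ) then (if (i : ℕ) < d then 1 else -1) else 0

/-- The index of the direction opposite to direction `i`. -/
def opp {d : ℕ} (i : Fin (2 * d)) : Fin (2 * d) :=
  ⟨if (i : ℕ) < d then (i : ℕ) + d else (i : ℕ) - d, by have := i.isLt; split <;> omega⟩

/-- The set `𝒫` of probability vectors on the `2d` directions. -/
abbrev Simplex (d : ℕ) := {p : Fin (2 * d) → ℝ // (∀ i, 0 ≤ p i) ∧ ∑ i, p i = 1}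

/-- The environment space `Ω = 𝒫^{ℤ^d}`. -/
abbrev Env (d : ℕ) := V d → Simplex d

/-- The space of trajectories of the walk. -/
abbrev Traj (d : ℕ) := ℕ → V d

/-- Transition probability of the walk from `y` to `z` in environment `ω`. -/
noncomputable def trans (d : ℕ) (ω : Env d) (y z : V d) : ℝ :=
  ∑ i : Fin (2 * d), if z = y + dir d i then (ω y).1 i else 0

/-- `Pq` is the family of quenched laws: `Pq ω x` is a probability measure on trajectories,
starting at `x`, whose cylinder probabilities are given by the products of the transition
probabilities of the environment `ω`. -/
def IsQuenchedLaw (d : ℕ) (Pq : Env d → V d → Measure (Traj d)) : Prop :=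
  (∀ ω x, IsProbabilityMeasure (Pq ω x)) ∧
  ∀ (ω : Env d) (x : V d) (n : ℕ) (σ : ℕ → V d),
    (Pq ω x {f | ∀ k ≤ n, f k = σ k}).toReal =
      (if σ 0 = x then 1 else 0) * ∏ k ∈ Finset.range n, trans d ω (σ k) (σ (k + 1))

/-- The annealed (averaged) law `P_x = ∫ P_{x,ω} dℙ`. -/
noncomputable def annealed (d : ℕ) (ℙ : Measure (Env d)) (Pq : Env d → V d → Measure (Traj d))
    (x : V d) : Measure (Traj d) :=
  ℙ.bind (fun ω => Pq ω x)

/-- `{ω(x) : x ∈ ℤ^d}` are i.i.d. under `ℙ`, with one-site marginal `μ`. -/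
def IsIIDWith (d : ℕ) (ℙ : Measure (Env d)) (μ : Measure (Simplex d)) : Prop :=
  IsProbabilityMeasure ℙ ∧ IsProbabilityMeasure μ ∧
  ∀ (s : Finset (V d)) (A : V d → Set (Simplex d)), (∀ x, MeasurableSet (A x)) →
    ℙ {ω | ∀ x ∈ s, ω x ∈ A x} = ∏ x ∈ s, μ (A x)

/-- `{ω(x) : x ∈ ℤ^d}` are i.i.d. under `ℙ`. -/
def IsIID (d : ℕ) (ℙ : Measure (Env d)) : Prop :=
  ∃ μ : Measure (Simplex d), IsIIDWith d ℙ μ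

/-- `ℙ` is elliptic. -/
def IsElliptic (d : ℕ) (ℙ : Measure (Env d)) : Prop :=
  ∀ (x : V d) (i : Fin (2 * d)), ℙ {ω | 0 < (ω x).1 i} = 1

/-- First exit time from a set `A` (with value `0` by convention if the walk never leaves `A`). -/
noncomputable def exitTime (d : ℕ) (A : Set (V d)) (f : Traj d) : ℕ :=
  sInf {n | f n ∉ A}

/-- The coordinates of a site, as a real vector. -/
def toR (d : ℕ) (x : V d) : Fin d → ℝ := fun j => (x j : ℝ)

/-- Euclidean inner product of a site with a real vector `l`. -/
noncomputable def dotl (d : ℕ) (l : Fin d → ℝ) (x : V d) : ℝ :=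
  ∑ j, (x j : ℝ) * l j

/-- The first canonical basis vector `e_1` of `ℝ^d`. -/
def e1 (d : ℕ) : Fin d → ℝ := fun j => if (j : ℕ) = 0 then 1 else 0

/-- `R` is a rotation of `ℝ^d`: a linear automorphism preserving the Euclidean inner
product, with determinant one. -/
def IsRotation (d : ℕ) (R : (Fin d → ℝ) ≃ₗ[ℝ] (Fin d → ℝ)) : Prop :=
  (∀ u v : Fin d → ℝ, ∑ j, R u j * R v j = ∑ j, u j * v j) ∧
    LinearMap.det (R : (Fin d → ℝ) →ₗ[ℝ] (Fin d → ℝ)) = 1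

/-- The box `B_{l,L,L̃} = R((-L,L) × (-L̃,L̃)^{d-1}) ∩ ℤ^d`, where `R` is a rotation
with `R e_1 = l`. -/
def box (d : ℕ) (R : (Fin d → ℝ) ≃ₗ[ℝ] (Fin d → ℝ)) (L Lt : ℝ) : Set (V d) :=
  {x | ∀ j : Fin d,
    if (j : ℕ) = 0 then -L < R.symm (toR d x) j ∧ R.symm (toR d x) j < L
    else -Lt < R.symm (toR d x) j ∧ R.symm (toR d x) j < Lt}

/-- The polynomial condition `(P)_M` in direction `l` on a box of size `L`. -/
def PolyCond (d : ℕ) (ℙ : Measure (Env d)) (Pq : Env d → V d → Measure (Traj d))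
    (l : Fin d → ℝ) (M L : ℝ) : Prop :=
  ∃ Lt : ℝ, 0 < Lt ∧ Lt ≤ 70 * L ^ 3 ∧
  ∃ R : (Fin d → ℝ) ≃ₗ[ℝ] (Fin d → ℝ), IsRotation d R ∧ R (e1 d) = l ∧
    ((annealed d ℙ Pq 0) {f | dotl d l (f (exitTime d (box d R L Lt) f)) < L}).toReal ≤ 1 / L ^ M

/-- The quantity `η_α = max_{e ∈ U} 𝔼[ω(0,e)^{-α}]`. -/
noncomputable def eta (d : ℕ) (ℙ : Measure (Env d)) (α : ℝ) : ℝ≥0∞ :=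
  ⨆ i : Fin (2 * d), ∫⁻ ω, ENNReal.ofReal ((ω 0).1 i ^ (-α)) ∂ℙ

/-- `ᾱ = sup{α ≥ 0 : η_α < ∞}`. -/
noncomputable def alphaBar (d : ℕ) (ℙ : Measure (Env d)) : ℝ :=
  sSup {α : ℝ | 0 ≤ α ∧ eta d ℙ α < ⊤}

/-- The constant `c_0 = (2/3)·3^{120d⁴ + 3000d(log η_{ᾱ/2})²}`. -/
noncomputable def c0 (d : ℕ) (ℙ : Measure (Env d)) : ℝ :=
  (2 / 3) * (3 : ℝ) ^ (120 * (d : ℝ) ^ 4 +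
    3000 * (d : ℝ) * (Real.log (eta d ℙ (alphaBar d ℙ / 2)).toReal) ^ 2)

/-- The ellipticity condition `(E')_β`. -/
def CondE (d : ℕ) (ℙ : Measure (Env d)) (β : ℝ) : Prop :=
  ∃ α : Fin (2 * d) → ℝ, (∀ i, 0 < α i) ∧
    (∀ i, 2 * (∑ j, α j) - (α i + α (opp i)) > β) ∧
    ∀ i : Fin (2 * d),
      ∫⁻ ω, ∏ j ∈ Finset.univ.erase i, ENNReal.ofReal ((ω 0).1 j ^ (-(α j))) ∂ℙ < ⊤


/-- First `n` with `P n`, as an extended natural number (`⊤` if there is none). -/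
noncomputable def firstTime (P : ℕ → Prop) : ℕ∞ :=
  if ∃ n, P n then ((sInf {n | P n} : ℕ) : ℕ∞) else ⊤

/-- The triple `(S_k, R_k, M_k)` of the regeneration construction in direction `l`
with parameter `a`. -/
noncomputable def SR (d : ℕ) (l : Fin d → ℝ) (a : ℝ) (f : Traj d) : ℕ → ℕ∞ × ℕ∞ × ℝ
  | 0 => (0, 0, dotl d l (f 0))
  | (k + 1) =>
      let M := (SR d l a f k).2.2
      let S : ℕ∞ := firstTime fun n => M + a ≤ dotl d l (f n)
      let s : ℕ := S.toNat
      let R : ℕ∞ := if S = ⊤ then ⊤ else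
        S + firstTime fun n => dotl d l (f (s + n)) < dotl d l (f s)
      let M' : ℝ := sSup {r : ℝ | ∃ n : ℕ, (n : ℕ∞) ≤ R ∧ r = dotl d l (f n)}
      (S, R, M')

/-- The first regeneration time `τ_1` in direction `l` with parameter `a`. -/
noncomputable def tau1 (d : ℕ) (l : Fin d → ℝ) (a : ℝ) (f : Traj d) : ℕ∞ :=
  if _h : ∃ k : ℕ, 1 ≤ k ∧ (SR d l a f k).1 ≠ ⊤ ∧ (SR d l a f k).2.1 = ⊤ then
    (SR d l a f (sInf {k : ℕ | 1 ≤ k ∧ (SR d l a f k).1 ≠ ⊤ ∧ (SR d l a f k).2.1 = ⊤})).1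
  else ⊤

/-- The event `τ_1 > u` for a real threshold `u`. -/
def tau1Gt (d : ℕ) (l : Fin d → ℝ) (a : ℝ) (u : ℝ) : Set (Traj d) :=
  {f | ∀ k : ℕ, tau1 d l a f = (k : ℕ∞) → u < (k : ℝ)}

/-- `v` is the asymptotic direction of the walk under the law `P0`:
`X_n/|X_n|₂ → v` almost surely. -/
def HasAsympDir (d : ℕ) (P0 : Measure (Traj d)) (v : Fin d → ℝ) : Prop :=
  ∀ᵐ f ∂P0, Tendsto
    (fun n => fun j : Fin d => (f n j : ℝ) / Real.sqrt (∑ j', ((f n j' : ℝ)) ^ 2))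
    atTop (𝓝 v)

/-- `γ` is the centered Gaussian measure on `ι → ℝ` with covariance matrix `C`:
every linear functional pushes it forward to a one-dimensional centered Gaussian with
the corresponding variance. -/
def IsCenteredGaussian {ι : Type*} [Fintype ι] (γ : Measure (ι → ℝ)) (C : ι → ι → ℝ) : Prop :=
  ∀ u : ι → ℝ, γ.map (fun x => ∑ i, u i * x i) =
    ProbabilityTheory.gaussianReal 0 (Real.toNNReal (∑ i, ∑ j, u i * C i j * u j))

/-- `ε^{1/2}(X_{⌊ε⁻¹n⌋} - ⌊ε⁻¹n⌋ v)` converges in law under `P0`, as `ε → 0`, to a Brownian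
motion with non-degenerate covariance matrix `C`: the finite-dimensional distributions at any
times `t : Fin k → ℕ` converge weakly to the centered Gaussian with covariance
`min(t_p, t_q)·C`. -/
def CLTtoBM (d : ℕ) (P0 : Measure (Traj d)) (v : Fin d → ℝ)
    (Cmat : Matrix (Fin d) (Fin d) ℝ) : Prop :=
  ∀ (k : ℕ) (t : Fin k → ℕ),
    ∃ γ : Measure (Fin k × Fin d → ℝ), IsProbabilityMeasure γ ∧
      IsCenteredGaussian γ (fun p q => (min (t p.1) (t q.1) : ℝ) * Cmat p.2 q.2) ∧
      ∀ g : BoundedContinuousFunction ((Fin k × Fin d) → ℝ) ℝ,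
        Tendsto (fun ε : ℝ =>
            ∫ f : Traj d, g (fun p =>
              Real.sqrt ε * ((f (⌊(t p.1 : ℝ) / ε⌋₊) p.2 : ℝ) - (⌊(t p.1 : ℝ) / ε⌋₊ : ℝ) * v p.2))
              ∂P0)
          (𝓝[>] (0 : ℝ)) (𝓝 (∫ x, g x ∂γ))

/-- `μ` is the Dirichlet distribution with parameters `β` on the simplex, characterized by
its (joint polynomial) moments. -/
def IsDirichlet (d : ℕ) (μ : Measure (Simplex d)) (β : Fin (2 * d) → ℝ) : Prop :=
  IsProbabilityMeasure μ ∧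
  ∀ k : Fin (2 * d) → ℕ,
    ∫ p, ∏ i, (p.1 i) ^ (k i) ∂μ =
      (Real.Gamma (∑ i, β i) / Real.Gamma ((∑ i, β i) + (∑ i, (k i : ℝ)))) *
        ∏ i, (Real.Gamma (β i + k i) / Real.Gamma (β i))

/-! ### Directed graph structure on `ℤ^d` and flows -/

/-- Directed nearest-neighbour edges of `ℤ^d`: the pair `(z, i)` represents the edge from
`z` to `z + dir d i`. -/
abbrev Edge (d : ℕ) := V d × Fin (2 * d)

def tail (d : ℕ) (e : Edge d) : V d := e.1

def head (d : ℕ) (e : Edge d) : V d := e.1 + dir d e.2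

/-- Divergence of an edge function at a vertex. -/
noncomputable def divg (d : ℕ) (θ : Edge d → ℝ) (v : V d) : ℝ :=
  (∑ᶠ e ∈ {e : Edge d | tail d e = v}, θ e) - ∑ᶠ e ∈ {e : Edge d | head d e = v}, θ e

/-- `θ` is a flow from `A` to `Z` on the directed graph `(ℤ^d, E_{ℤ^d})`. -/
def IsFlow (d : ℕ) (θ : Edge d → ℝ) (A Z : Set (V d)) : Prop :=
  (∀ e, 0 ≤ θ e) ∧ (∀ v, v ∉ A ∪ Z → divg d θ v = 0) ∧
    (∀ v ∈ A, 0 ≤ divg d θ v) ∧ (∀ v ∈ Z, divg d θ v ≤ 0)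

/-- `θ` is a unit flow from `A` to `Z`. -/
def IsUnitFlow (d : ℕ) (θ : Edge d → ℝ) (A Z : Set (V d)) : Prop :=
  IsFlow d θ A Z ∧ ∑ᶠ v ∈ A, divg d θ v = 1


section helpers

variable {d : ℕ}

lemma idxz (hd : 1 ≤ d) : 0 < 2 * d := Nat.mul_pos Nat.two_pos hd

lemma idxd (hd : 1 ≤ d) : d < 2 * d := lt_mul_of_one_lt_left hd one_lt_two

/-- End point of the path with list of directions `w` (newest first). -/
def pos : List (Fin (2 * d)) → V d
  | [] => 0
  | i :: w => pos w + dir d i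

/-- Sites visited strictly before the end. -/
noncomputable def vis : List (Fin (2 * d)) → Finset (V d)
  | [] => ∅
  | _ :: w => insert (pos w) (vis w)

/-- Quenched weight of the path. -/
noncomputable def wt (ω : Env d) : List (Fin (2 * d)) → ℝ≥0∞
  | [] => 1
  | i :: w => wt ω w * ENNReal.ofReal ((ω (pos w)).1 i)

/-- Trajectories that start with the path. -/
def fol : List (Fin (2 * d)) → Set (Traj d)
  | [] => {f | f 0 = 0}
  | i :: w => fol w ∩ {f | f (w.length + 1) = pos w + dir d i}

lemma fol_last (w : List (Fin (2 * d))) (f : Traj d) (hf : f ∈ fol w) : f w.length = pos w := by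
  cases w with
  | nil => exact hf
  | cons i w => exact hf.2

lemma fol_vis (w : List (Fin (2 * d))) (f : Traj d) (hf : f ∈ fol w) :
    ∀ k < w.length, f k ∈ vis w := by
  induction w with
  | nil => intro k hk; simp at hk
  | cons i w ih =>
    intro k hk
    simp only [vis, Finset.mem_insert]
    rcases Nat.lt_or_ge k w.length with h | h
    · exact Or.inr (ih hf.1 k h)
    · left
      have : k = w.length := by simp at hk; omega
      rw [this]; exact fol_last w f hf.1

lemma measurable_fol (w : List (Fin (2 * d))) : MeasurableSet (fol w) := by
  induction w with
  | nil => exact measurable_pi_apply 0 (MeasurableSet.singleton 0)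
  | cons i w ih =>
    exact ih.inter (measurable_pi_apply (w.length + 1) (MeasurableSet.singleton _))

lemma dir_inj {i j : Fin (2 * d)} (h : dir d i = dir d j) : i = j := by
  have hi := i.isLt
  have hj := j.isLt
  ext
  by_cases h1 : (i : ℕ) < d
  · have := congrFun h ⟨i, h1⟩
    simp only [dir] at this
    split_ifs at this <;> simp_all <;> omega
  · have := congrFun h ⟨i - d, by omega⟩
    simp only [dir] at this
    split_ifs at this <;> simp_all <;> omega

lemma trans_dir (ω : Env d) (y : V d) (i : Fin (2 * d)) :
    trans d ω y (y + dir d i) = (ω y).1 i := by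
  unfold trans
  rw [Finset.sum_eq_single i]
  · simp
  · intro b _ hb
    rw [if_neg]
    intro h
    exact hb (dir_inj (add_left_cancel h)).symm
  · simp

lemma trans_nonneg (ω : Env d) (y z : V d) : 0 ≤ trans d ω y z := by
  unfold trans
  refine Finset.sum_nonneg fun i _ => ?_
  split_ifs
  · exact (ω y).2.1 i
  · exact le_rfl

lemma trans_zero (ω : Env d) (y z : V d) (h : ∀ i, z ≠ y + dir d i) : trans d ω y z = 0 := by
  unfold trans
  exact Finset.sum_eq_zero fun i _ => if_neg (h i)

lemma cyl (Pq : Env d → V d → Measure (Traj d)) (hQ : IsQuenchedLaw d Pq) (ω : Env d)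
    (n : ℕ) (σ : ℕ → V d) (h0 : σ 0 = 0) :
    Pq ω 0 {f | ∀ k ≤ n, f k = σ k} =
      ENNReal.ofReal (∏ k ∈ Finset.range n, trans d ω (σ k) (σ (k + 1))) := by
  have := hQ.1 ω 0
  have h := hQ.2 ω 0 n σ
  rw [if_pos h0, one_mul] at h
  rw [← h, ENNReal.ofReal_toReal (measure_ne_top _ _)]

lemma upd_set (n : ℕ) (σ : ℕ → V d) (z : V d) :
    {f : Traj d | ∀ k ≤ n + 1, f k = Function.update σ (n + 1) z k} =
      {f | ∀ k ≤ n, f k = σ k} ∩ {f | f (n + 1) = z} := by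
  ext f
  simp only [Set.mem_ofPred_eq, Set.mem_inter_iff]
  constructor
  · intro h
    refine ⟨fun k hk => ?_, ?_⟩
    · have := h k (by omega)
      rwa [Function.update_of_ne (by omega)] at this
    · simpa using h (n + 1) le_rfl
  · rintro ⟨h1, h2⟩ k hk
    rcases Nat.lt_or_ge k (n + 1) with h | h
    · rw [Function.update_of_ne (by omega)]; exact h1 k (by omega)
    · have : k = n + 1 := by omega
      subst this; simpa using h2

lemma upd_prod (ω : Env d) (n : ℕ) (σ : ℕ → V d) (z : V d) :
    ∏ k ∈ Finset.range (n + 1), trans d ω (Function.update σ (n + 1) z k)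
        (Function.update σ (n + 1) z (k + 1)) =
      (∏ k ∈ Finset.range n, trans d ω (σ k) (σ (k + 1))) * trans d ω (σ n) z := by
  rw [Finset.prod_range_succ]
  congr 1
  · refine Finset.prod_congr rfl fun k hk => ?_
    have := Finset.mem_range.1 hk
    rw [Function.update_of_ne (by omega), Function.update_of_ne (by omega)]
  · rw [Function.update_of_ne (by omega), Function.update_self]

lemma fol_path (ω : Env d) (w : List (Fin (2 * d))) : ∃ σ : ℕ → V d, σ 0 = 0 ∧
    σ w.length = pos w ∧ fol w = {f | ∀ k ≤ w.length, f k = σ k} ∧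
    ENNReal.ofReal (∏ k ∈ Finset.range w.length, trans d ω (σ k) (σ (k + 1))) = wt ω w := by
  induction w with
  | nil => exact ⟨fun _ => 0, rfl, rfl, by simp [fol], by simp [wt]⟩
  | cons i w ih =>
    obtain ⟨σ, h0, h1, h2, h3⟩ := ih
    refine ⟨Function.update σ (w.length + 1) (pos w + dir d i), ?_, ?_, ?_, ?_⟩
    · rw [Function.update_of_ne (by omega)]; exact h0
    · simp [pos]
    · rw [List.length_cons, upd_set, fol, h2]
    · rw [List.length_cons, upd_prod, ENNReal.ofReal_mul
        (Finset.prod_nonneg fun _ _ => trans_nonneg _ _ _), h3, h1, trans_dir, wt]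

lemma fol_next (Pq : Env d → V d → Measure (Traj d)) (hQ : IsQuenchedLaw d Pq) (ω : Env d)
    (w : List (Fin (2 * d))) (z : V d) :
    Pq ω 0 (fol w ∩ {f | f (w.length + 1) = z}) =
      wt ω w * ENNReal.ofReal (trans d ω (pos w) z) := by
  obtain ⟨σ, h0, h1, h2, h3⟩ := fol_path ω w
  rw [h2, ← upd_set, cyl Pq hQ ω _ _ (by rw [Function.update_of_ne (by omega)]; exact h0),
    upd_prod, ENNReal.ofReal_mul (Finset.prod_nonneg fun _ _ => trans_nonneg _ _ _), h3, h1]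

lemma fol_meas (Pq : Env d → V d → Measure (Traj d)) (hQ : IsQuenchedLaw d Pq) (ω : Env d)
    (w : List (Fin (2 * d))) : Pq ω 0 (fol w) = wt ω w := by
  obtain ⟨σ, h0, h1, h2, h3⟩ := fol_path ω w
  rw [h2, cyl Pq hQ ω _ _ h0, h3]

lemma split (Pq : Env d → V d → Measure (Traj d)) (hQ : IsQuenchedLaw d Pq) (ω : Env d)
    (w : List (Fin (2 * d))) (E : Set (Traj d)) :
    Pq ω 0 (fol w ∩ E) ≤ ∑ i, Pq ω 0 (fol (i :: w) ∩ E) := by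
  have hsub : fol w ∩ E ⊆ (⋃ i ∈ (Finset.univ : Finset (Fin (2 * d))), (fol (i :: w) ∩ E)) ∪
      ⋃ z ∈ {z : V d | ∀ i, z ≠ pos w + dir d i}, (fol w ∩ {f | f (w.length + 1) = z}) := by
    rintro f ⟨hf, hE⟩
    by_cases h : ∃ i, f (w.length + 1) = pos w + dir d i
    · obtain ⟨i, hi⟩ := h
      left
      simp only [Set.mem_iUnion]
      exact ⟨i, Finset.mem_univ _, ⟨hf, hi⟩, hE⟩
    · right
      push Not at h
      simp only [Set.mem_iUnion]
      exact ⟨f (w.length + 1), h, hf, rfl⟩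
  refine (measure_mono hsub).trans ((measure_union_le _ _).trans ?_)
  have : Pq ω 0 (⋃ z ∈ {z : V d | ∀ i, z ≠ pos w + dir d i},
      (fol w ∩ {f | f (w.length + 1) = z})) = 0 := by
    rw [measure_biUnion_null_iff (Set.to_countable _)]
    intro z hz
    rw [fol_next Pq hQ, trans_zero _ _ _ hz]; simp
  rw [this, add_zero]
  exact measure_biUnion_finset_le _ _

lemma wt_measurable (w : List (Fin (2 * d))) : Measurable fun ω : Env d => wt ω w := by
  induction w with
  | nil => exact measurable_const
  | cons i w ih =>
    refine ih.mul (Measurable.ennreal_ofReal ?_)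
    exact (measurable_pi_apply i).comp (measurable_subtype_coe.comp (measurable_pi_apply (pos w)))

/-- the weight depends only on the sites visited -/
lemma wt_dep (w : List (Fin (2 * d))) (S : Finset (V d)) (hS : vis w ⊆ S) :
    ∃ φ : (S → Simplex d) → ℝ≥0∞, Measurable φ ∧
      ∀ ω : Env d, wt ω w = φ (fun x : S => ω x) := by
  induction w with
  | nil => exact ⟨fun _ => 1, measurable_const, fun _ => rfl⟩
  | cons i w ih =>
    simp only [vis, Finset.insert_subset_iff] at hS
    obtain ⟨φ, hφ, h⟩ := ih hS.2
    refine ⟨fun p => φ p * ENNReal.ofReal ((p ⟨pos w, hS.1⟩).1 i), ?_, fun ω => ?_⟩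
    · refine hφ.mul (Measurable.ennreal_ofReal ?_)
      exact (measurable_pi_apply i).comp (measurable_subtype_coe.comp (measurable_pi_apply _))
    · rw [wt, h]

lemma iid_map {ℙ : Measure (Env d)} {μ : Measure (Simplex d)} (h : IsIIDWith d ℙ μ) (x : V d) :
    ℙ.map (fun ω => ω x) = μ := by
  ext s hs
  rw [Measure.map_apply (measurable_pi_apply x) hs]
  have := h.2.2 {x} (fun _ => s) (fun _ => hs)
  simp only [Finset.mem_singleton, forall_eq, Finset.prod_singleton] at this
  exact this

lemma iid_indep {ℙ : Measure (Env d)} {μ : Measure (Simplex d)} (h : IsIIDWith d ℙ μ) :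
    ProbabilityTheory.iIndepFun (fun (x : V d) (ω : Env d) => ω x) ℙ := by
  rw [ProbabilityTheory.iIndepFun_iff_measure_inter_preimage_eq_mul]
  intro S sets hsets
  have key := h.2.2 S (fun x => if x ∈ S then sets x else Set.univ) (by
    intro x
    split_ifs with hx
    · exact hsets x hx
    · exact MeasurableSet.univ)
  have e1 : {ω : Env d | ∀ x ∈ S, ω x ∈ (if x ∈ S then sets x else Set.univ)} =
      ⋂ i ∈ S, (fun ω : Env d => ω i) ⁻¹' sets i := by
    ext ω
    simp only [Set.mem_ofPred_eq, Set.mem_iInter, Set.mem_preimage]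
    refine forall₂_congr fun x hx => ?_
    rw [if_pos hx]
  rw [e1] at key
  rw [key]
  refine Finset.prod_congr rfl fun x hx => ?_
  rw [if_pos hx, ← iid_map h x, Measure.map_apply (measurable_pi_apply x) (hsets x hx)]

lemma fresh {ℙ : Measure (Env d)} {μ : Measure (Simplex d)} (h : IsIIDWith d ℙ μ)
    (w : List (Fin (2 * d))) (hw : pos w ∉ vis w) (g : Simplex d → ℝ≥0∞) (hg : Measurable g) :
    ∫⁻ ω, wt ω w * g (ω (pos w)) ∂ℙ = (∫⁻ ω, wt ω w ∂ℙ) * ∫⁻ p, g p ∂μ := by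
  obtain ⟨φ, hφ, hwt⟩ := wt_dep w (vis w) subset_rfl
  have hi := (iid_indep h).indepFun_finset (vis w) {pos w} (by simpa using hw)
    (fun i => measurable_pi_apply i)
  have hψ : Measurable (fun p : ({pos w} : Finset (V d)) → Simplex d =>
      g (p ⟨pos w, Finset.mem_singleton_self _⟩)) :=
    hg.comp (measurable_pi_apply (⟨pos w, Finset.mem_singleton_self _⟩ :
      ({pos w} : Finset (V d))))
  have hi2 := hi.comp hφ hψ
  have h3 := ProbabilityTheory.lintegral_mul_eq_lintegral_mul_lintegral_of_indepFun
    (μ := ℙ) (f := fun ω => wt ω w) (g := fun ω => g (ω (pos w)))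
    (wt_measurable w) (hg.comp (measurable_pi_apply _)) (by
      have : (fun ω => wt ω w) = φ ∘ fun (a : Env d) (i : vis w) => a i := by
        funext ω; exact hwt ω
      rw [this]
      exact hi2)
  rw [← iid_map h (pos w), lintegral_map hg (measurable_pi_apply (pos w))]
  exact h3

lemma vis_range (w : List (Fin (2 * d))) (j : Fin d) :
    Finset.range (pos w j).natAbs ⊆ (vis w).image (fun x => (x j).natAbs) := by
  induction w with
  | nil => simp [pos]
  | cons i w ih =>
    intro m hm
    rw [Finset.mem_range] at hm
    have hstep : (pos (i :: w) j).natAbs ≤ (pos w j).natAbs + 1 := by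
      simp only [pos, Pi.add_apply, dir]
      split_ifs <;> omega
    simp only [vis, Finset.image_insert, Finset.mem_insert]
    rcases Nat.lt_or_ge m (pos w j).natAbs with h | h
    · right; exact ih (Finset.mem_range.2 h)
    · left; omega

lemma vis_card (w : List (Fin (2 * d))) (j : Fin d) : (pos w j).natAbs ≤ (vis w).card := by
  have := Finset.card_le_card (vis_range w j)
  rw [Finset.card_range] at this
  exact this.trans Finset.card_image_le

/-- One step computation. -/
lemma one_step (hd : 1 ≤ d) (p : Simplex d) (r a : ℝ) (ha : 0 < a)
    (hp : p.1 ⟨0, idxz hd⟩ = r * p.1 ⟨d, idxd hd⟩) :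
    ∑ i, ENNReal.ofReal (p.1 i) * ENNReal.ofReal (a ^ (dir d i ⟨0, hd⟩)) =
      ENNReal.ofReal (1 - (1 - a) * (r - 1 / a) * p.1 ⟨d, idxd hd⟩) := by
  have h1 : ∀ i, ENNReal.ofReal (p.1 i) * ENNReal.ofReal (a ^ (dir d i ⟨0, hd⟩)) =
      ENNReal.ofReal (p.1 i * a ^ (dir d i ⟨0, hd⟩)) := fun i =>
    (ENNReal.ofReal_mul (p.2.1 i)).symm
  simp_rw [h1]
  rw [← ENNReal.ofReal_sum_of_nonneg (fun i _ => mul_nonneg (p.2.1 i) (zpow_nonneg ha.le _))]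
  congr 1
  have h2 : ∀ i : Fin (2 * d), p.1 i * a ^ (dir d i ⟨0, hd⟩) = p.1 i +
      ((if i = ⟨0, idxz hd⟩ then p.1 i * (a - 1) else 0) +
        (if i = ⟨d, idxd hd⟩ then p.1 i * (1 / a - 1) else 0)) := by
    intro i
    have hi := i.isLt
    by_cases e0 : i = ⟨0, idxz hd⟩
    · have : i ≠ ⟨d, idxd hd⟩ := by rw [e0]; intro h; simp at h; omega
      rw [if_pos e0, if_neg this]
      have : dir d i ⟨0, hd⟩ = 1 := by
        rw [e0]; simp [dir]; omega
      rw [this]; simp; ring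
    · by_cases e1 : i = ⟨d, idxd hd⟩
      · rw [if_neg e0, if_pos e1]
        have : dir d i ⟨0, hd⟩ = -1 := by
          rw [e1]; simp [dir]
        rw [this]; simp; ring
      · rw [if_neg e0, if_neg e1]
        have : dir d i ⟨0, hd⟩ = 0 := by
          have g0 : (i : ℕ) ≠ 0 := fun h => e0 (Fin.ext h)
          have g1 : (i : ℕ) ≠ d := fun h => e1 (Fin.ext h)
          simp only [dir]
          rw [if_neg]
          omega
        rw [this]; simp
  simp_rw [h2]
  rw [Finset.sum_add_distrib, Finset.sum_add_distrib, Finset.sum_ite_eq', Finset.sum_ite_eq',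
    p.2.2]
  simp only [Finset.mem_univ, if_true]
  rw [hp]
  field_simp
  ring

/-- Exit from `B` by time `n` at a site of `G`. -/
def BadE (B G : Set (V d)) (n : ℕ) : Set (Traj d) :=
  {f | ∃ k ≤ n, f k ∈ G ∧ f k ∉ B ∧ ∀ j < k, f j ∈ B}

lemma measurable_BadE (B G : Set (V d)) (n : ℕ) : MeasurableSet (BadE B G n) := by
  have : BadE B G n = ⋃ k ∈ Set.Iic n, (((fun f : Traj d => f k) ⁻¹' G) ∩
      ((fun f : Traj d => f k) ⁻¹' Bᶜ) ∩ ⋂ j ∈ Set.Iio k, (fun f : Traj d => f j) ⁻¹' B) := by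
    ext f
    simp [BadE, and_assoc]
    grind
  rw [this]
  have hm : ∀ S : Set (V d), MeasurableSet S := fun S => S.to_countable.measurableSet
  refine MeasurableSet.biUnion (Set.to_countable _) fun k _ => ?_
  refine ((measurable_pi_apply k (hm _)).inter (measurable_pi_apply k (hm _))).inter ?_
  exact MeasurableSet.biInter (Set.to_countable _) fun j _ => measurable_pi_apply j (hm _)

lemma stay_bound (hd : 1 ≤ d) (Pq : Env d → V d → Measure (Traj d)) (hQ : IsQuenchedLaw d Pq)
    (ω : Env d) (r a : ℝ) (ha : 0 < a) (ha1 : a < 1)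
    (hrel : ∀ x, (ω x).1 ⟨0, idxz hd⟩ = r * (ω x).1 ⟨d, idxd hd⟩)
    (B : Set (V d)) (L : ℤ) (hB : ∀ x ∈ B, x ⟨0, hd⟩ ≤ L) (δ : ℝ≥0∞)
    (hδ : ∀ x ∈ B, ENNReal.ofReal (1 - (1 - a) * (r - 1 / a) * (ω x).1 ⟨d, idxd hd⟩) ≤ δ)
    (n : ℕ) (w : List (Fin (2 * d))) :
    Pq ω 0 (fol w ∩ {f | ∀ k ≤ w.length + n, f k ∈ B}) ≤
      wt ω w * ENNReal.ofReal (a ^ (pos w ⟨0, hd⟩ - L)) * δ ^ n := by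
  induction n generalizing w with
  | zero =>
    by_cases h : pos w ∈ B
    · refine (measure_mono Set.inter_subset_left).trans ?_
      rw [fol_meas Pq hQ, pow_zero, mul_one]
      refine le_mul_of_one_le_right' ?_
      rw [ENNReal.one_le_ofReal]
      exact one_le_zpow_of_nonpos₀ ha ha1.le (by linarith [hB _ h])
    · have : fol w ∩ {f | ∀ k ≤ w.length + 0, f k ∈ B} = ∅ := by
        ext f
        simp only [Set.mem_inter_iff, Set.mem_empty_iff_false, iff_false]
        rintro ⟨h1, h2⟩
        exact h (fol_last w f h1 ▸ h2 w.length (by omega))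
      rw [this]; simp
  | succ n ih =>
    by_cases h : pos w ∈ B
    · refine (split Pq hQ ω w _).trans ?_
      calc ∑ i, Pq ω 0 (fol (i :: w) ∩ {f | ∀ k ≤ w.length + (n + 1), f k ∈ B})
          ≤ ∑ i, (wt ω w * ENNReal.ofReal (a ^ (pos w ⟨0, hd⟩ - L)) * δ ^ n) *
              (ENNReal.ofReal ((ω (pos w)).1 i) * ENNReal.ofReal (a ^ (dir d i ⟨0, hd⟩))) := by
            refine Finset.sum_le_sum fun i _ => ?_
            have := ih (i :: w)
            rw [List.length_cons, show w.length + 1 + n = w.length + (n + 1) by omega] at this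
            refine this.trans (le_of_eq ?_)
            rw [wt, pos, Pi.add_apply, show pos w ⟨0, hd⟩ + dir d i ⟨0, hd⟩ - L =
              (pos w ⟨0, hd⟩ - L) + dir d i ⟨0, hd⟩ by ring, zpow_add₀ ha.ne',
              ENNReal.ofReal_mul (zpow_nonneg ha.le _)]
            ring
        _ = (wt ω w * ENNReal.ofReal (a ^ (pos w ⟨0, hd⟩ - L)) * δ ^ n) *
              ENNReal.ofReal (1 - (1 - a) * (r - 1 / a) * (ω (pos w)).1 ⟨d, idxd hd⟩) := by
            rw [← Finset.mul_sum, one_step hd (ω (pos w)) r a ha (hrel _)]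
        _ ≤ (wt ω w * ENNReal.ofReal (a ^ (pos w ⟨0, hd⟩ - L)) * δ ^ n) * δ := by
            gcongr
            exact hδ _ h
        _ = _ := by ring
    · have : fol w ∩ {f | ∀ k ≤ w.length + (n + 1), f k ∈ B} = ∅ := by
        ext f
        simp only [Set.mem_inter_iff, Set.mem_empty_iff_false, iff_false]
        rintro ⟨h1, h2⟩
        exact h (fol_last w f h1 ▸ h2 w.length (by omega))
      rw [this]; simp

lemma bad_bound (hd : 1 ≤ d) (ℙ : Measure (Env d)) (μ : Measure (Simplex d))
    (hI : IsIIDWith d ℙ μ)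
    (Pq : Env d → V d → Measure (Traj d)) (hQ : IsQuenchedLaw d Pq)
    (hm : AEMeasurable (fun ω => Pq ω 0) ℙ)
    (r a : ℝ) (ha : 0 < a) (hκ : 0 ≤ (1 - a) * (r - 1 / a))
    (hrel : ∀ᵐ ω ∂ℙ, ∀ x, (ω x).1 ⟨0, idxz hd⟩ = r * (ω x).1 ⟨d, idxd hd⟩)
    (B G : Set (V d)) (C l : ℝ≥0∞)
    (hl : l * ∫⁻ p, ENNReal.ofReal (1 - (1 - a) * (r - 1 / a) * p.1 ⟨d, idxd hd⟩) ∂μ ≤ 1)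
    (hC : ∀ w : List (Fin (2 * d)), pos w ∉ B → pos w ∈ G →
      1 ≤ C * ENNReal.ofReal (a ^ (pos w ⟨0, hd⟩)) * l ^ (vis w).card)
    (n : ℕ) (w : List (Fin (2 * d))) (hw : ∀ x ∈ vis w, x ∈ B) :
    ∫⁻ ω, Pq ω 0 (fol w ∩ BadE B G (w.length + n)) ∂ℙ ≤
      C * ENNReal.ofReal (a ^ (pos w ⟨0, hd⟩)) * l ^ (vis w).card * ∫⁻ ω, wt ω w ∂ℙ := by
  have hout : ∀ (n : ℕ) (w : List (Fin (2 * d))), (∀ x ∈ vis w, x ∈ B) → pos w ∉ B →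
    ∫⁻ ω, Pq ω 0 (fol w ∩ BadE B G (w.length + n)) ∂ℙ ≤
      C * ENNReal.ofReal (a ^ (pos w ⟨0, hd⟩)) * l ^ (vis w).card * ∫⁻ ω, wt ω w ∂ℙ := by
    intro n w hw h
    by_cases hG : pos w ∈ G
    · calc ∫⁻ ω, Pq ω 0 (fol w ∩ BadE B G (w.length + n)) ∂ℙ
          ≤ ∫⁻ ω, wt ω w ∂ℙ := by
            refine lintegral_mono fun ω => ?_
            rw [← fol_meas Pq hQ]
            exact measure_mono Set.inter_subset_left
        _ ≤ _ := le_mul_of_one_le_left' (hC w h hG)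
    · have : fol w ∩ BadE B G (w.length + n) = ∅ := by
        ext f
        simp only [Set.mem_inter_iff, Set.mem_empty_iff_false, iff_false]
        rintro ⟨h1, k, hk, h2, h3, h4⟩
        rcases lt_trichotomy k w.length with hlt | heq | hgt
        · exact h3 (hw _ (fol_vis w f h1 k hlt))
        · rw [heq, fol_last w f h1] at h2; exact hG h2
        · exact h (fol_last w f h1 ▸ h4 _ hgt)
      rw [this]; simp
  induction n generalizing w with
  | zero =>
    by_cases h : pos w ∈ B
    · have : fol w ∩ BadE B G (w.length + 0) = ∅ := by
        ext f
        simp only [Set.mem_inter_iff, Set.mem_empty_iff_false, iff_false]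
        rintro ⟨h1, k, hk, h2, h3, h4⟩
        rcases Nat.lt_or_ge k w.length with hlt | hge
        · exact h3 (hw _ (fol_vis w f h1 k hlt))
        · have : k = w.length := by omega
          rw [this, fol_last w f h1] at h3; exact h3 h
      rw [this]; simp
    · exact hout 0 w hw h
  | succ n ih =>
    by_cases h : pos w ∈ B
    swap
    · exact hout (n + 1) w hw h
    set K : Simplex d → ℝ≥0∞ := fun p =>
      ENNReal.ofReal (1 - (1 - a) * (r - 1 / a) * p.1 ⟨d, idxd hd⟩) with hK
    have hKm : Measurable K := by
      refine Measurable.ennreal_ofReal (measurable_const.sub (measurable_const.mul ?_))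
      exact (measurable_pi_apply _).comp measurable_subtype_coe
    have hωm : ∀ i, Measurable fun ω : Env d => ENNReal.ofReal ((ω (pos w)).1 i) := fun i =>
      Measurable.ennreal_ofReal ((measurable_pi_apply i).comp
        (measurable_subtype_coe.comp (measurable_pi_apply (pos w))))
    set A := C * ENNReal.ofReal (a ^ (pos w ⟨0, hd⟩)) with hA
    set N := (insert (pos w) (vis w)).card with hN
    have hK1 : ∀ p, K p ≤ 1 := by
      intro p
      rw [hK, ENNReal.ofReal_le_one]
      nlinarith [mul_nonneg hκ (p.2.1 ⟨d, idxd hd⟩)]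
    calc ∫⁻ ω, Pq ω 0 (fol w ∩ BadE B G (w.length + (n + 1))) ∂ℙ
        ≤ ∫⁻ ω, ∑ i, Pq ω 0 (fol (i :: w) ∩ BadE B G (w.length + (n + 1))) ∂ℙ :=
          lintegral_mono fun ω => split Pq hQ ω w _
      _ = ∑ i, ∫⁻ ω, Pq ω 0 (fol (i :: w) ∩ BadE B G (w.length + (n + 1))) ∂ℙ := by
          refine lintegral_finsetSum' _ fun i _ => ?_
          exact (Measure.measurable_coe
            ((measurable_fol _).inter (measurable_BadE _ _ _))).comp_aemeasurable hm
      _ ≤ ∑ i, C * ENNReal.ofReal (a ^ (pos (i :: w) ⟨0, hd⟩)) * l ^ (vis (i :: w)).card *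
            ∫⁻ ω, wt ω (i :: w) ∂ℙ := by
          refine Finset.sum_le_sum fun i _ => ?_
          have := ih (i :: w) (by
            simp only [vis, Finset.mem_insert]
            rintro x (rfl | hx)
            · exact h
            · exact hw x hx)
          rwa [List.length_cons, show w.length + 1 + n = w.length + (n + 1) by omega] at this
      _ = ∑ i, A * l ^ N * ∫⁻ ω, wt ω w * (ENNReal.ofReal ((ω (pos w)).1 i) *
            ENNReal.ofReal (a ^ (dir d i ⟨0, hd⟩))) ∂ℙ := by
          refine Finset.sum_congr rfl fun i _ => ?_
          simp only [← mul_assoc]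
          have hmi : Measurable fun ω : Env d => wt ω w * ENNReal.ofReal ((ω (pos w)).1 i) :=
            (wt_measurable w).mul (hωm i)
          rw [lintegral_mul_const _ hmi]
          simp only [pos, wt, vis, Pi.add_apply]
          rw [zpow_add₀ ha.ne', ENNReal.ofReal_mul (zpow_nonneg ha.le _)]
          ring
      _ = A * l ^ N * ∫⁻ ω, wt ω w * K (ω (pos w)) ∂ℙ := by
          have hmi : ∀ i, Measurable fun ω : Env d => wt ω w *
              (ENNReal.ofReal ((ω (pos w)).1 i) * ENNReal.ofReal (a ^ (dir d i ⟨0, hd⟩))) :=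
            fun i => (wt_measurable w).mul ((hωm i).mul_const _)
          rw [← Finset.mul_sum, ← lintegral_finsetSum _ fun i _ => hmi i]
          congr 1
          refine lintegral_congr_ae ?_
          filter_upwards [hrel] with ω hω
          rw [← Finset.mul_sum, one_step hd (ω (pos w)) r a ha (hω _)]
      _ ≤ A * l ^ (vis w).card * ∫⁻ ω, wt ω w ∂ℙ := by
          by_cases hf : pos w ∈ vis w
          · rw [hN, Finset.insert_eq_of_mem hf]
            gcongr with ω
            exact mul_le_of_le_one_right' (hK1 _)
          · rw [hN, Finset.card_insert_of_notMem hf, fresh hI w hf K hKm, pow_succ]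
            calc A * (l ^ (vis w).card * l) * ((∫⁻ ω, wt ω w ∂ℙ) * ∫⁻ p, K p ∂μ)
                = A * l ^ (vis w).card * (∫⁻ ω, wt ω w ∂ℙ) * (l * ∫⁻ p, K p ∂μ) := by ring
              _ ≤ A * l ^ (vis w).card * (∫⁻ ω, wt ω w ∂ℙ) * 1 := by gcongr
              _ = _ := by ring

lemma start_full (Pq : Env d → V d → Measure (Traj d)) (hQ : IsQuenchedLaw d Pq) (ω : Env d)
    (E : Set (Traj d)) : Pq ω 0 E ≤ Pq ω 0 (fol ([] : List (Fin (2 * d))) ∩ E) := by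
  have := hQ.1 ω 0
  have h1 : Pq ω 0 (fol ([] : List (Fin (2 * d))))ᶜ = 0 := by
    rw [prob_compl_eq_zero_iff (measurable_fol _), fol_meas Pq hQ]; rfl
  calc Pq ω 0 E ≤ Pq ω 0 ((fol ([] : List (Fin (2 * d))) ∩ E) ∪ (fol [])ᶜ) := by
        refine measure_mono fun f hf => ?_
        by_cases h : f ∈ fol ([] : List (Fin (2 * d)))
        · exact Or.inl ⟨h, hf⟩
        · exact Or.inr h
    _ ≤ _ := (measure_union_le _ _).trans (by rw [h1, add_zero])

lemma stay_zero (hd : 1 ≤ d) (Pq : Env d → V d → Measure (Traj d)) (hQ : IsQuenchedLaw d Pq)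
    (ω : Env d) (r a : ℝ) (ha : 0 < a) (ha1 : a < 1) (hκ : 0 < (1 - a) * (r - 1 / a))
    (hrel : ∀ x, (ω x).1 ⟨0, idxz hd⟩ = r * (ω x).1 ⟨d, idxd hd⟩)
    (hpos : ∀ x, 0 < (ω x).1 ⟨d, idxd hd⟩)
    (B : Set (V d)) (hfin : B.Finite) (L : ℤ) (hB : ∀ x ∈ B, x ⟨0, hd⟩ ≤ L) :
    Pq ω 0 {f | ∀ k, f k ∈ B} = 0 := by
  obtain ⟨δ, hδ1, hδ⟩ : ∃ δ : ℝ≥0∞, δ < 1 ∧ ∀ x ∈ B,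
      ENNReal.ofReal (1 - (1 - a) * (r - 1 / a) * (ω x).1 ⟨d, idxd hd⟩) ≤ δ := by
    refine ⟨hfin.toFinset.sup fun x =>
      ENNReal.ofReal (1 - (1 - a) * (r - 1 / a) * (ω x).1 ⟨d, idxd hd⟩), ?_, ?_⟩
    · rw [Finset.sup_lt_iff (by simp)]
      intro x _
      rw [ENNReal.ofReal_lt_one]
      have := mul_pos hκ (hpos x)
      linarith
    · intro x hx
      exact Finset.le_sup (f := fun x =>
        ENNReal.ofReal (1 - (1 - a) * (r - 1 / a) * (ω x).1 ⟨d, idxd hd⟩))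
        (hfin.mem_toFinset.2 hx)
  have hb : ∀ n : ℕ, Pq ω 0 {f | ∀ k, f k ∈ B} ≤ ENNReal.ofReal (a ^ (-L)) * δ ^ n := by
    intro n
    refine (start_full Pq hQ ω _).trans ?_
    have := stay_bound hd Pq hQ ω r a ha ha1 hrel B L hB δ hδ n []
    simp only [wt, pos, one_mul, Pi.zero_apply, zero_sub] at this
    refine (measure_mono ?_).trans this
    rintro f ⟨h1, h2⟩
    exact ⟨h1, fun k _ => h2 k⟩
  have ht : Tendsto (fun n : ℕ => ENNReal.ofReal (a ^ (-L)) * δ ^ n) atTop (𝓝 0) := by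
    have := ENNReal.Tendsto.const_mul (a := ENNReal.ofReal (a ^ (-L)))
      (ENNReal.tendsto_pow_atTop_nhds_zero_of_lt_one hδ1) (Or.inr ENNReal.ofReal_ne_top)
    simpa using this
  exact le_antisymm (ge_of_tendsto' ht hb) zero_le

lemma dotl_e1 (hd : 1 ≤ d) (x : V d) : dotl d (e1 d) x = x ⟨0, hd⟩ := by
  unfold dotl e1
  rw [Finset.sum_eq_single ⟨0, hd⟩]
  · simp
  · intro b _ hb
    rw [if_neg (fun h => hb (Fin.ext h))]; simp
  · simp

lemma mem_box_refl (x : V d) (L Lt : ℝ) : x ∈ box d (LinearEquiv.refl ℝ _) L Lt ↔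
    ∀ j : Fin d, if (j : ℕ) = 0 then -L < (x j : ℝ) ∧ (x j : ℝ) < L
      else -Lt < (x j : ℝ) ∧ (x j : ℝ) < Lt := Iff.rfl

lemma box_finite (L Lt : ℝ) : (box d (LinearEquiv.refl ℝ _) L Lt).Finite := by
  refine (Set.finite_Icc (fun _ : Fin d => -⌈max L Lt⌉) (fun _ => ⌈max L Lt⌉)).subset ?_
  intro x hx
  rw [mem_box_refl] at hx
  have key : ∀ j, -(⌈max L Lt⌉ : ℝ) < x j ∧ (x j : ℝ) < ⌈max L Lt⌉ := by
    intro j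
    have h1 := Int.le_ceil (max L Lt)
    have h2 := le_max_left L Lt
    have h3 := le_max_right L Lt
    have := hx j
    split_ifs at this
    · exact ⟨by linarith [this.1], by linarith [this.2]⟩
    · exact ⟨by linarith [this.1], by linarith [this.2]⟩
  refine ⟨fun j => ?_, fun j => ?_⟩
  · have := (key j).1
    have : -⌈max L Lt⌉ < x j := by exact_mod_cast this
    exact this.le
  · have := (key j).2
    have : x j < ⌈max L Lt⌉ := by exact_mod_cast this
    exact this.le

lemma exit_weight (hd : 1 ≤ d) (a lam : ℝ) (ha : 0 < a) (ha1 : a < 1) (hlam : 1 < lam) (N : ℕ)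
    (hN : 1 ≤ N) (hal : 1 ≤ a * lam ^ N) (w : List (Fin (2 * d)))
    (hB : pos w ∉ box d (LinearEquiv.refl ℝ _) (N : ℝ) (70 * (N : ℝ) ^ 3))
    (hG : pos w ⟨0, hd⟩ < N) :
    1 ≤ ENNReal.ofReal (a ^ N) * ENNReal.ofReal (a ^ (pos w ⟨0, hd⟩)) *
      ENNReal.ofReal lam ^ (vis w).card := by
  have hl0 : (0 : ℝ) ≤ lam := by linarith
  rw [← ENNReal.ofReal_pow hl0, ← ENNReal.ofReal_mul (by positivity),
    ← ENNReal.ofReal_mul (by positivity), ENNReal.one_le_ofReal]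
  have hc1 : 1 ≤ lam ^ (vis w).card := one_le_pow₀ hlam.le
  by_cases hback : pos w ⟨0, hd⟩ ≤ -(N : ℤ)
  · have : 1 ≤ a ^ N * a ^ (pos w ⟨0, hd⟩) := by
      rw [← zpow_natCast, ← zpow_add₀ ha.ne']
      exact one_le_zpow_of_nonpos₀ ha ha1.le (by linarith)
    nlinarith
  · push Not at hback
    have hj : ∃ j : Fin d, 70 * N ^ 3 ≤ (pos w j).natAbs := by
      by_contra hcon
      push Not at hcon
      apply hB
      rw [mem_box_refl]
      intro j
      split_ifs with h0
      · have : j = ⟨0, hd⟩ := Fin.ext h0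
        rw [this]
        exact ⟨by exact_mod_cast hback, by exact_mod_cast hG⟩
      · have h1 := hcon j
        have h2 : -(70 * (N : ℤ) ^ 3) < pos w j ∧ pos w j < 70 * (N : ℤ) ^ 3 := by
          zify at h1
          exact abs_lt.1 h1
        exact ⟨by exact_mod_cast h2.1, by exact_mod_cast h2.2⟩
    obtain ⟨j, hj⟩ := hj
    have hcard : N * (2 * N) ≤ (vis w).card := by
      refine le_trans ?_ (hj.trans (vis_card w j))
      nlinarith [Nat.pow_le_pow_left hN 2, sq_nonneg N, pow_succ N 2]
    have h1 : a ^ N ≤ a ^ (pos w ⟨0, hd⟩) := by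
      rw [← zpow_natCast]
      exact zpow_le_zpow_right_of_le_one₀ ha ha1.le hG.le
    have h2 : lam ^ (N * (2 * N)) ≤ lam ^ (vis w).card := pow_le_pow_right₀ hlam.le hcard
    calc (1 : ℝ) ≤ (a * lam ^ N) ^ (2 * N) := one_le_pow₀ hal
      _ = a ^ N * a ^ N * lam ^ (N * (2 * N)) := by
          rw [mul_pow, ← pow_mul, two_mul N, pow_add]
      _ ≤ _ := by gcongr

end helpers

/-- **Theorem (marginal nestling example).**
Consider an elliptic i.i.d. law `ℙ` such that for some `r > 1`, `ℙ`-a.s.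
`ω(0,e₁) = r·ω(0,e_{1+d})`. Then the polynomial condition `(P)_M|e₁` is satisfied for some
`M ≥ 15d+5` on a box of size `L ≥ c₀`. -/
theorem marginal_nestling
    (d : ℕ) (hd : 1 ≤ d)
    (ℙ : Measure (Env d)) (Pq : Env d → V d → Measure (Traj d))
    (hQ : IsQuenchedLaw d Pq) (hIID : IsIID d ℙ) (hEll : IsElliptic d ℙ)
    (r : ℝ) (hr : 1 < r)
    (hrel : ℙ {ω | (ω 0).1 ⟨0, by omega⟩ = r * (ω 0).1 ⟨d, by omega⟩} = 1) :
    ∃ M : ℝ, 15 * d + 5 ≤ M ∧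
      ∃ L : ℝ, 2 ≤ L ∧ c0 d ℙ ≤ L ∧ PolyCond d ℙ Pq (e1 d) M L := by
  obtain ⟨μ, hI⟩ := hIID
  have hP1 := hI.1
  have hP2 := hI.2.1
  set a : ℝ := 2 / (1 + r) with ha_def
  have ha : 0 < a := by positivity
  have ha1 : a < 1 := by rw [ha_def, div_lt_one (by linarith)]; linarith
  have hκ : 0 < (1 - a) * (r - 1 / a) := by
    have h1 : 1 / a = (1 + r) / 2 := by rw [ha_def, one_div_div]
    rw [h1]
    exact mul_pos (by linarith) (by linarith)
  have hcm : ∀ i : Fin (2 * d), Measurable fun p : Simplex d => p.1 i := fun i =>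
    (measurable_pi_apply i).comp measurable_subtype_coe
  have toae : ∀ (x : V d) (A : Set (Simplex d)), MeasurableSet A → ℙ {ω | ω x ∈ A} = 1 →
      ∀ᵐ p ∂μ, p ∈ A := by
    intro x A hA h
    have hx : Measurable fun ω : Env d => ω x := measurable_pi_apply x
    rw [← iid_map hI x]
    refine (ae_map_iff (p := fun p : Simplex d => p ∈ A) hx.aemeasurable hA).2 ?_
    exact (mem_ae_iff_prob_eq_one (hx hA)).2 h
  have ofae : ∀ (A : Set (Simplex d)), (∀ᵐ p ∂μ, p ∈ A) → ∀ᵐ ω ∂ℙ, ∀ x, ω x ∈ A := by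
    intro A h
    rw [ae_all_iff]
    intro x
    rw [← iid_map hI x] at h
    exact ae_of_ae_map (measurable_pi_apply x).aemeasurable h
  have hrelμ := toae 0 {p | p.1 ⟨0, by omega⟩ = r * p.1 ⟨d, by omega⟩}
    (measurableSet_eq_fun (hcm _) ((hcm _).const_mul r)) hrel
  have hposμ := toae 0 {p | 0 < p.1 ⟨d, by omega⟩}
    (measurableSet_lt measurable_const (hcm _)) (hEll 0 ⟨d, by omega⟩)
  have hrelP : ∀ᵐ ω ∂ℙ, ∀ x, (ω x).1 ⟨0, by omega⟩ = r * (ω x).1 ⟨d, by omega⟩ := ofae _ hrelμ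
  have hposP : ∀ᵐ ω ∂ℙ, ∀ x, 0 < (ω x).1 ⟨d, by omega⟩ := ofae _ hposμ
  obtain ⟨lam, hlam, hl⟩ : ∃ lam : ℝ, 1 < lam ∧ ENNReal.ofReal lam *
      ∫⁻ p, ENNReal.ofReal (1 - (1 - a) * (r - 1 / a) * p.1 ⟨d, by omega⟩) ∂μ ≤ 1 := by
    set g := ∫⁻ p : Simplex d,
      ENNReal.ofReal (1 - (1 - a) * (r - 1 / a) * p.1 ⟨d, by omega⟩) ∂μ with hg
    have hle : ∀ p : Simplex d,
        ENNReal.ofReal (1 - (1 - a) * (r - 1 / a) * p.1 ⟨d, by omega⟩) ≤ 1 := by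
      intro p
      rw [ENNReal.ofReal_le_one]
      nlinarith [mul_nonneg hκ.le (p.2.1 ⟨d, by omega⟩)]
    have hg1 : g ≤ 1 := by
      calc g ≤ ∫⁻ _, 1 ∂μ := lintegral_mono hle
        _ = 1 := by simp
    have hglt : g < 1 := by
      calc g < ∫⁻ _, 1 ∂μ := by
            refine lintegral_strict_mono (IsProbabilityMeasure.ne_zero μ)
              aemeasurable_const (ne_top_of_le_ne_top ENNReal.one_ne_top hg1) ?_
            filter_upwards [hposμ] with p hp
            rw [ENNReal.ofReal_lt_one]
            have := mul_pos hκ hp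
            linarith
        _ = 1 := by simp
    have hgtop : g ≠ ⊤ := ne_top_of_le_ne_top ENNReal.one_ne_top hg1
    have hg0 : 0 ≤ g.toReal := ENNReal.toReal_nonneg
    have hgr : g.toReal < 1 := by
      have := (ENNReal.toReal_lt_toReal hgtop ENNReal.one_ne_top).2 hglt
      simpa using this
    refine ⟨2 / (1 + g.toReal), ?_, ?_⟩
    · rw [lt_div_iff₀ (by linarith)]; linarith
    · rw [← ENNReal.ofReal_toReal hgtop, ← ENNReal.ofReal_mul (by positivity),
        ENNReal.ofReal_le_one, ENNReal.toReal_ofReal hg0, div_mul_eq_mul_div,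
        div_le_one (by linarith)]
      linarith
  have ev1 : ∀ᶠ N : ℕ in atTop, (N : ℝ) ^ (15 * d + 5) * a ^ N < 1 :=
    (tendsto_pow_const_mul_const_pow_of_abs_lt_one (15 * d + 5)
      (by rw [abs_of_pos ha]; exact ha1)).eventually_lt_const one_pos
  have ev2 : ∀ᶠ N : ℕ in atTop, 1 / a ≤ lam ^ N :=
    (tendsto_pow_atTop_atTop_of_one_lt hlam).eventually_ge_atTop _
  have ev3 : ∀ᶠ N : ℕ in atTop, c0 d ℙ ≤ (N : ℝ) :=
    tendsto_natCast_atTop_atTop.eventually_ge_atTop _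
  obtain ⟨N, hN1, hN2, hN3, hN4⟩ :=
    (ev1.and (ev2.and (ev3.and (eventually_ge_atTop 2)))).exists
  have hN0 : (0 : ℝ) < N := by exact_mod_cast (by omega : 0 < N)
  refine ⟨((15 * d + 5 : ℕ) : ℝ), by push_cast; rfl, N, by exact_mod_cast hN4, hN3,
    70 * (N : ℝ) ^ 3, by positivity, le_rfl, LinearEquiv.refl ℝ _, ⟨fun u v => rfl, ?_⟩, rfl, ?_⟩
  · exact LinearMap.det_id
  have hfinal : annealed d ℙ Pq 0 {f | dotl d (e1 d)
      (f (exitTime d (box d (LinearEquiv.refl ℝ _) N (70 * (N : ℝ) ^ 3)) f)) < N} ≤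
      ENNReal.ofReal (a ^ N) := by
    by_cases hm : AEMeasurable (fun ω => Pq ω 0) ℙ
    swap
    · have : annealed d ℙ Pq 0 = 0 := by
        unfold annealed Measure.bind
        rw [Measure.map_of_not_aemeasurable hm, Measure.join_zero]
      rw [this]; simp
    set B := box d (LinearEquiv.refl ℝ _) (N : ℝ) (70 * (N : ℝ) ^ 3) with hBdef
    set G : Set (V d) := {x | x ⟨0, hd⟩ < (N : ℤ)} with hGdef
    have hsub : {f : Traj d | dotl d (e1 d) (f (exitTime d B f)) < N} ⊆
        (⋃ n, BadE B G n) ∪ {f | ∀ k, f k ∈ B} := by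
      intro f hf
      by_cases hs : ∀ k, f k ∈ B
      · exact Or.inr hs
      · left
        push Not at hs
        have hne : {n | f n ∉ B}.Nonempty := hs
        rw [Set.mem_iUnion]
        refine ⟨exitTime d B f, exitTime d B f, le_rfl, ?_, Nat.sInf_mem hne, ?_⟩
        · have h1 : dotl d (e1 d) (f (exitTime d B f)) < N := hf
          rw [dotl_e1 hd] at h1
          have h2 : f (exitTime d B f) ⟨0, hd⟩ < (N : ℤ) := by exact_mod_cast h1
          exact h2
        · intro j hj
          by_contra hcon
          exact Nat.notMem_of_lt_sInf hj hcon
    have hbad : ∀ n, annealed d ℙ Pq 0 (BadE B G n) ≤ ENNReal.ofReal (a ^ N) := by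
      intro n
      unfold annealed
      rw [Measure.bind_apply (measurable_BadE _ _ _) hm]
      refine (lintegral_mono fun ω => start_full Pq hQ ω _).trans ?_
      have := bad_bound hd ℙ μ hI Pq hQ hm r a ha hκ.le hrelP B G (ENNReal.ofReal (a ^ N))
        (ENNReal.ofReal lam) hl (fun w h1 h2 => exit_weight hd a lam ha ha1 hlam N (by omega)
          (by rw [div_le_iff₀ ha] at hN2; linarith) w h1 h2) n [] (by simp [vis])
      simpa [wt, vis, pos] using this
    have hmono : Monotone fun n => BadE B G n := by
      rintro n m hnm f ⟨k, hk, h⟩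
      exact ⟨k, hk.trans hnm, h⟩
    have hstay : annealed d ℙ Pq 0 {f | ∀ k, f k ∈ B} = 0 := by
      have hms : MeasurableSet {f : Traj d | ∀ k, f k ∈ B} := by
        have : {f : Traj d | ∀ k, f k ∈ B} = ⋂ k, (fun f : Traj d => f k) ⁻¹' B := by
          ext f; simp
        rw [this]
        exact MeasurableSet.iInter fun k => measurable_pi_apply k B.to_countable.measurableSet
      unfold annealed
      rw [Measure.bind_apply hms hm]
      refine lintegral_eq_zero_of_ae_eq_zero ?_
      filter_upwards [hrelP, hposP] with ω h1 h2
      refine stay_zero hd Pq hQ ω r a ha ha1 hκ h1 h2 B (box_finite _ _) N fun x hx => ?_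
      have := ((mem_box_refl x _ _).1 hx) ⟨0, hd⟩
      rw [if_pos rfl] at this
      have h3 : x ⟨0, hd⟩ < (N : ℤ) := by exact_mod_cast this.2
      exact h3.le
    refine (measure_mono hsub).trans ((measure_union_le _ _).trans ?_)
    rw [hstay, add_zero, hmono.measure_iUnion]
    exact iSup_le hbad
  refine (ENNReal.toReal_mono ENNReal.ofReal_ne_top hfinal).trans ?_
  rw [ENNReal.toReal_ofReal (by positivity), Real.rpow_natCast, le_div_iff₀ (by positivity)]
  linarith

end RWRE
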